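/- Let λ>0. There exists a constant C>0, depending only on λ, such that for every real b with -1<b<1, one has ∫_{-1}^{1} (1-bs)^{-(λ+1)} (1+s)(1-s²)^{λ-1} ds ≤ C/(1-|b|). -/

import Mathlib

open MeasureTheory Set in
theorem dunkl_aux (l : ℝ) (hl : 0 < l) (b : ℝ) (hb0 : 0 ≤ b) (hb1 : b < 1) :
    IntegrableOn (fun s : ℝ => (1 - b * s) ^ (-(l + 1)) * (1 - s) ^ (l - 1)) (Ioo (-1) 1) ∧
    ∫ s in Ioo (-1 : ℝ) 1, (1 - b * s) ^ (-(l + 1)) * (1 - s) ^ (l - 1)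
      ≤ 2 ^ l / l / (1 - b) := by
  have hd : 0 < 1 - b := by linarith
  have hpos : ∀ s ∈ Icc (-1 : ℝ) 1, 0 < 1 - b * s := by
    intro s hs
    nlinarith [hs.1, hs.2, mul_nonneg hb0 (sub_nonneg.2 hs.2)]
  set F : ℝ → ℝ := fun s => -(((1 - s) / (1 - b * s)) ^ l / (l * (1 - b))) with hF
  have hcont : ContinuousOn F (Icc (-1) 1) := by
    apply ContinuousOn.neg
    apply ContinuousOn.div_const
    apply ContinuousOn.rpow_const
    · apply ContinuousOn.div (by fun_prop) (by fun_prop)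
      intro s hs
      exact (hpos s hs).ne'
    · intro s hs
      right; exact hl.le
  have hderiv : ∀ s ∈ Ioo (-1 : ℝ) 1,
      HasDerivAt F ((1 - b * s) ^ (-(l + 1)) * (1 - s) ^ (l - 1)) s := by
    intro s hs
    have hp := hpos s (Ioo_subset_Icc_self hs)
    have h1 : 0 < 1 - s := by linarith [hs.2]
    have hn : HasDerivAt (fun s : ℝ => 1 - s) (-1) s := by
      simpa using (hasDerivAt_id s).const_sub 1
    have hm : HasDerivAt (fun s : ℝ => 1 - b * s) (-b) s := by
      simpa using ((hasDerivAt_id s).const_mul b).const_sub 1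
    have hq := (((hn.div hm hp.ne').rpow_const (p := l)
      (Or.inl (div_pos h1 hp).ne')).div_const (l * (1 - b))).neg
    refine hq.congr_deriv ?_
    simp only [Pi.div_apply]
    rw [Real.div_rpow h1.le hp.le, show -(l + 1) = -(l - 1) - 2 by ring,
      Real.rpow_sub hp (-(l - 1)) 2, Real.rpow_neg hp.le, Real.rpow_two]
    have := (Real.rpow_pos_of_pos hp (l - 1)).ne'
    generalize (1 - b * s) ^ (l - 1) = A at *
    field_simp
    ring
  have hnn : ∀ s ∈ Ioo (-1 : ℝ) 1, 0 ≤ (1 - b * s) ^ (-(l + 1)) * (1 - s) ^ (l - 1) := by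
    intro s hs
    have hp := hpos s (Ioo_subset_Icc_self hs)
    have h1 : 0 < 1 - s := by linarith [hs.2]
    positivity
  have hint := intervalIntegral.integrableOn_deriv_of_nonneg hcont hderiv hnn
  refine ⟨hint.mono_set Ioo_subset_Ioc_self, ?_⟩
  have hle : (-1 : ℝ) ≤ 1 := by norm_num
  have h := intervalIntegral.integral_eq_sub_of_hasDerivAt_of_le hle hcont hderiv
    ((intervalIntegrable_iff_integrableOn_Ioc_of_le hle).2 hint)
  rw [intervalIntegral.integral_of_le hle, integral_Ioc_eq_integral_Ioo] at h
  rw [h]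
  simp only [hF, sub_self, zero_div, Real.zero_rpow hl.ne', neg_zero, zero_sub, neg_neg]
  rw [div_div]
  have hb2 : (0 : ℝ) < 1 - b * -1 := by linarith
  gcongr
  rw [div_le_iff₀ hb2]
  linarith

open MeasureTheory Set in
/-- For λ>0 there is C>0 (depending only on λ) such that for every
`-1 < b < 1`,
`∫_{-1}^{1} (1-bs)^{-(λ+1)} (1+s)(1-s²)^{λ-1} ds ≤ C/(1-|b|)`. -/
theorem dunkl_kernel_integral_estimate (l : ℝ) (hl : 0 < l) :
    ∃ C : ℝ, 0 < C ∧ ∀ b : ℝ, -1 < b → b < 1 →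
      (∫ s in Set.Ioo (-1 : ℝ) 1,
          (1 - b * s) ^ (-(l + 1)) * (1 + s) * (1 - s ^ 2) ^ (l - 1))
        ≤ C / (1 - |b|) := by
  refine ⟨2 ^ l * (2 ^ l / l), by positivity, ?_⟩
  intro b hb hb1
  have hpos : ∀ s ∈ Ioo (-1 : ℝ) 1, 1 - |b| ≤ 1 - b * s := by
    intro s hs
    have : b * s ≤ |b| * 1 := (le_abs_self _).trans (by
      rw [abs_mul]; gcongr; exact abs_le.2 ⟨hs.1.le, hs.2.le⟩)
    linarith
  have hd : 0 < 1 - |b| := by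
    have : |b| < 1 := abs_lt.2 ⟨hb, hb1⟩
    linarith
  have hrw : ∀ s ∈ Ioo (-1 : ℝ) 1, (1 - b * s) ^ (-(l + 1)) * (1 + s) * (1 - s ^ 2) ^ (l - 1)
      = (1 - b * s) ^ (-(l + 1)) * (1 + s) ^ l * (1 - s) ^ (l - 1) := by
    intro s hs
    have h1 : 0 < 1 - s := by linarith [hs.2]
    have h2 : 0 < 1 + s := by linarith [hs.1]
    rw [show 1 - s ^ 2 = (1 + s) * (1 - s) by ring, Real.mul_rpow h2.le h1.le,
      Real.rpow_sub_one h2.ne']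
    field_simp
  have hnn : ∀ᵐ s ∂(volume.restrict (Ioo (-1 : ℝ) 1)),
      0 ≤ (1 - b * s) ^ (-(l + 1)) * (1 + s) * (1 - s ^ 2) ^ (l - 1) := by
    refine (ae_restrict_iff' measurableSet_Ioo).2 (Filter.Eventually.of_forall fun s hs => ?_)
    have h1 : 0 < 1 - s := by linarith [hs.2]
    have h2 : 0 < 1 + s := by linarith [hs.1]
    have h3 := hd.trans_le (hpos s hs)
    rw [hrw s hs]
    positivity
  rcases le_or_gt 0 b with h0 | h0
  · obtain ⟨hi, hI⟩ := dunkl_aux l hl b h0 hb1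
    rw [abs_of_nonneg h0] at *
    rw [mul_div_assoc]
    refine le_trans ?_ (mul_le_mul_of_nonneg_left hI (by positivity))
    rw [← integral_const_mul]
    refine integral_mono_of_nonneg hnn (hi.const_mul _) ?_
    refine (ae_restrict_iff' measurableSet_Ioo).2 (Filter.Eventually.of_forall fun s hs => ?_)
    have h1 : 0 < 1 - s := by linarith [hs.2]
    have h2 : 0 < 1 + s := by linarith [hs.1]
    have h3 := hd.trans_le (hpos s hs)
    simp only [hrw s hs]
    have h4 : (1 + s) ^ l ≤ 2 ^ l := by gcongr; linarith [hs.2]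
    calc _ ≤ (1 - b * s) ^ (-(l + 1)) * 2 ^ l * (1 - s) ^ (l - 1) := by gcongr
      _ = _ := by ring
  · obtain ⟨hi, hI⟩ := dunkl_aux l hl 0 le_rfl one_pos
    simp only [zero_mul, sub_zero, Real.one_rpow, one_mul, div_one] at hi hI
    rw [mul_div_right_comm]
    refine le_trans ?_ (mul_le_mul_of_nonneg_left hI (by positivity))
    rw [← integral_const_mul]
    refine integral_mono_of_nonneg hnn (hi.const_mul _) ?_
    refine (ae_restrict_iff' measurableSet_Ioo).2 (Filter.Eventually.of_forall fun s hs => ?_)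
    have h1 : 0 < 1 - s := by linarith [hs.2]
    have h2 : 0 < 1 + s := by linarith [hs.1]
    have h3 := hd.trans_le (hpos s hs)
    simp only [hrw s hs]
    have h4 : (1 + s) ^ l ≤ 2 ^ l * (1 - b * s) ^ l := by
      rw [← Real.mul_rpow (by norm_num) h3.le]
      gcongr
      nlinarith [mul_pos (neg_pos.2 h0) h2, mul_pos (by linarith : 0 < 1 + b) h1]
    have h5 : (1 - b * s) ^ (-(l + 1)) * (1 - b * s) ^ l = (1 - b * s)⁻¹ := by
      rw [← Real.rpow_add h3, ← Real.rpow_neg_one]; congr 1; ring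
    calc _ ≤ (1 - b * s) ^ (-(l + 1)) * (2 ^ l * (1 - b * s) ^ l) * (1 - s) ^ (l - 1) := by gcongr
      _ = 2 ^ l * (1 - b * s)⁻¹ * (1 - s) ^ (l - 1) := by rw [← h5]; ring
      _ ≤ 2 ^ l * (1 - |b|)⁻¹ * (1 - s) ^ (l - 1) := by gcongr; linarith [hpos s hs]
      _ = _ := by rw [div_eq_mul_inv]
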